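/- arXiv:1705.09236 — 3 statements merged into one kernel-verified Lean document; each statement's English description precedes it below -/
import Mathlib

section
/- Let s ∈ (0, 1], let m ≥ 1 be a real number, set β = 2 log(m), and let Z be a real random variable with Gaussian distribution of mean -√β · s and variance s². Then E[Z · 1{Z > 0}] ≤ 1/(√(2π) · m). -/
open MeasureTheory ProbabilityTheory Real

theorem integral_Ioi_mul_exp_neg_mul_sq {b : ℝ} (hb : 0 < b) :
    ∫ x in Set.Ioi (0 : ℝ), x * exp (-b * x ^ 2) = (2 * b)⁻¹ := by
  have hderiv : ∀ x ∈ Set.Ici (0 : ℝ),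
      HasDerivAt (fun x ↦ -(2 * b)⁻¹ * exp (-b * x ^ 2)) (x * exp (-b * x ^ 2)) x := by
    intro x _
    convert! ((((hasDerivAt_pow 2 x).const_mul (-b)).exp).const_mul (-(2 * b)⁻¹)) using 1
    push_cast
    field_simp
  have hlim : Filter.Tendsto (fun x : ℝ ↦ -(2 * b)⁻¹ * exp (-b * x ^ 2)) Filter.atTop (nhds 0) := by
    have h : Filter.Tendsto (fun x : ℝ ↦ -b * x ^ 2) Filter.atTop Filter.atBot :=
      (Filter.tendsto_pow_atTop two_ne_zero).const_mul_atTop_of_neg (neg_neg_of_pos hb)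
    simpa using (tendsto_exp_atBot.comp h).const_mul (-(2 * b)⁻¹)
  rw [integral_Ioi_of_hasDerivAt_of_nonneg' hderiv
    (fun x hx ↦ mul_nonneg (le_of_lt hx) (exp_pos _).le) hlim]
  simp

theorem setIntegral_Ioi_gaussianReal_le (t : ℝ) (ht : 0 ≤ t) (s : ℝ) (hs : 0 < s) :
    ∫ x in Set.Ioi 0, x ∂gaussianReal (-t * s) ⟨s ^ 2, sq_nonneg s⟩
      ≤ s * exp (-t ^ 2 / 2) / √(2 * π) := by
  have hv : (⟨s ^ 2, sq_nonneg s⟩ : NNReal) ≠ 0 := by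
    intro h
    exact (pow_pos hs 2).ne' (congrArg NNReal.toReal h)
  have hb : 0 < (2 * s ^ 2)⁻¹ := by positivity
  rw [← integral_indicator measurableSet_Ioi, integral_gaussianReal_eq_integral_smul hv]
  have hsqrt : √(2 * π * s ^ 2) = √(2 * π) * s := by
    rw [Real.sqrt_mul (by positivity), Real.sqrt_sq hs.le]
  have hpdf : ∀ x, 0 < x → gaussianPDFReal (-t * s) ⟨s ^ 2, sq_nonneg s⟩ x * x ≤
      exp (-t ^ 2 / 2) / (√(2 * π) * s) * (x * exp (-(2 * s ^ 2)⁻¹ * x ^ 2)) := by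
    intro x hx
    have hexp : exp (-(x - -t * s) ^ 2 / (2 * s ^ 2)) ≤
        exp (-t ^ 2 / 2) * exp (-(2 * s ^ 2)⁻¹ * x ^ 2) := by
      rw [← exp_add, exp_le_exp]
      have h : -t ^ 2 / 2 + -(2 * s ^ 2)⁻¹ * x ^ 2 - -(x - -t * s) ^ 2 / (2 * s ^ 2)
          = t * x / s := by
        field_simp
        ring
      have : 0 ≤ t * x / s := by positivity
      linarith
    change (√(2 * π * s ^ 2))⁻¹ * exp (-(x - -t * s) ^ 2 / (2 * s ^ 2)) * x ≤ _
    rw [hsqrt]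
    calc _ ≤ (√(2 * π) * s)⁻¹ * (exp (-t ^ 2 / 2) * exp (-(2 * s ^ 2)⁻¹ * x ^ 2)) * x := by
          gcongr
      _ = _ := by ring
  calc _ = ∫ x in Set.Ioi (0 : ℝ), gaussianPDFReal (-t * s) ⟨s ^ 2, sq_nonneg s⟩ x * x := by
        rw [← integral_indicator measurableSet_Ioi]
        congr with x
        by_cases hx : x ∈ Set.Ioi (0 : ℝ) <;> simp [hx]
    _ ≤ ∫ x in Set.Ioi (0 : ℝ),
        exp (-t ^ 2 / 2) / (√(2 * π) * s) * (x * exp (-(2 * s ^ 2)⁻¹ * x ^ 2)) := by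
      refine integral_mono_of_nonneg ?_
        ((integrable_mul_exp_neg_mul_sq hb).integrableOn.const_mul _) ?_
      · filter_upwards [ae_restrict_mem measurableSet_Ioi] with x hx
        exact mul_nonneg (gaussianPDFReal_nonneg _ _ _) (le_of_lt hx)
      · filter_upwards [ae_restrict_mem measurableSet_Ioi] with x hx
        exact hpdf x hx
    _ = s * exp (-t ^ 2 / 2) / √(2 * π) := by
      rw [integral_const_mul, integral_Ioi_mul_exp_neg_mul_sq hb]
      field_simp



/-- **Abstract form of the overshoot lemma (Lemma 12).** If `s ∈ (0,1]`, `m ≥ 1`,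
`β = 2 log m`, and `Z` has Gaussian law with mean `-√β · s` and variance `s²`, then
`E[Z · 1{Z > 0}] ≤ 1/(√(2π)·m)`. -/
theorem gaussian_overshoot_bound {Ω : Type*} [MeasurableSpace Ω] (P : Measure Ω)
    [IsProbabilityMeasure P] (Z : Ω → ℝ) (hZ : Measurable Z) (s m β : ℝ)
    (hs0 : 0 < s) (hs1 : s ≤ 1) (hm : 1 ≤ m) (hβ : β = 2 * Real.log m)
    (hlaw : P.map Z = gaussianReal (-Real.sqrt β * s) ⟨s ^ 2, sq_nonneg s⟩) :
    ∫ ω, Set.indicator {ω | 0 < Z ω} Z ω ∂P ≤ 1 / (Real.sqrt (2 * π) * m) := by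
  have hind : ∀ ω, Set.indicator {ω | 0 < Z ω} Z ω = (Set.Ioi (0 : ℝ)).indicator id (Z ω) :=
    fun ω ↦ rfl
  have hexp : exp (-√β ^ 2 / 2) = m⁻¹ := by
    rw [Real.sq_sqrt (by rw [hβ]; have := Real.log_nonneg hm; positivity), hβ,
      show -(2 * Real.log m) / 2 = -Real.log m by ring, exp_neg, exp_log (by positivity)]
  simp_rw [hind]
  rw [← integral_map hZ.aemeasurable
    (measurable_id.indicator measurableSet_Ioi).aestronglyMeasurable,
    integral_indicator measurableSet_Ioi, hlaw]
  refine (setIntegral_Ioi_gaussianReal_le √β (Real.sqrt_nonneg β) s hs0).trans ?_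
  rw [hexp]
  calc s * m⁻¹ / √(2 * π) ≤ 1 * m⁻¹ / √(2 * π) := by gcongr
    _ = 1 / (√(2 * π) * m) := by
      field_simp
end

section
/- For every real η > 0 and every real s with 0 ≤ s ≤ 1, it holds that s² ≤ log(1 + s²/η²) / log(1 + 1/η²). -/
/-- **Elementary inequality behind the constant `C₂ = 2/log(1+η⁻²)`.** For `η > 0`
and `s ∈ [0,1]`, `s² ≤ log(1 + s²/η²) / log(1 + 1/η²)`. -/
theorem sq_le_log_ratio (η s : ℝ) (hη : 0 < η) (hs0 : 0 ≤ s) (hs1 : s ≤ 1) :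
    s ^ 2 ≤ Real.log (1 + s ^ 2 / η ^ 2) / Real.log (1 + 1 / η ^ 2) := by
  have hx : 0 < 1 / η ^ 2 := by positivity
  rw [le_div_iff₀ (Real.log_pos (by linarith)), ← Real.log_rpow (by linarith)]
  refine Real.log_le_log (by positivity) ?_
  calc (1 + 1 / η ^ 2) ^ (s ^ 2 : ℝ) ≤ 1 + s ^ 2 * (1 / η ^ 2) :=
        rpow_one_add_le_one_add_mul_self (by linarith) (sq_nonneg s) (pow_le_one₀ hs0 hs1)
    _ = 1 + s ^ 2 / η ^ 2 := by rw [mul_one_div]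
end

section
/- Let η > 0 and let s₁, …, s_n be real numbers in [0,1] such that (1/2)·Σ_{j=1}^n log(1 + s_j²/η²) ≤ γ for some real γ ≥ 0. Then Σ_{j=1}^n s_j² ≤ 2γ/log(1 + 1/η²), and consequently Σ_{j=1}^n s_j ≤ √(2nγ/log(1 + 1/η²)). -/
/-- Concavity of `a ↦ log (1 + a)` along the segment from `0` to `a`. -/
theorem mul_log_one_add_le_log_one_add_mul {a t : ℝ} (ha : 0 ≤ a) (ht0 : 0 ≤ t) (ht1 : t ≤ 1) :
    t * Real.log (1 + a) ≤ Real.log (1 + t * a) := by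
  have hpos : 0 < 1 + a := by linarith
  rw [← Real.log_rpow hpos]
  exact Real.log_le_log (Real.rpow_pos_of_pos hpos t)
    (rpow_one_add_le_one_add_mul_self (by linarith) ht0 ht1)

/-- **Sum of posterior standard deviations bound (step (d) of the `A₄` bound).**
If `s₁,…,s_n ∈ [0,1]` and `(1/2)·Σ log(1 + s_j²/η²) ≤ γ` with `η > 0`, `γ ≥ 0`, then
`Σ s_j² ≤ 2γ/log(1+1/η²)` and `Σ s_j ≤ √(2nγ/log(1+1/η²))`. -/
theorem sum_sq_le_of_log_sum_le {n : ℕ} (η γ : ℝ) (hη : 0 < η) (hγ : 0 ≤ γ)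
    (s : Fin n → ℝ) (hs0 : ∀ j, 0 ≤ s j) (hs1 : ∀ j, s j ≤ 1)
    (hsum : (1 / 2) * ∑ j, Real.log (1 + (s j) ^ 2 / η ^ 2) ≤ γ) :
    (∑ j, (s j) ^ 2 ≤ 2 * γ / Real.log (1 + 1 / η ^ 2)) ∧
      (∑ j, s j ≤ Real.sqrt (2 * n * γ / Real.log (1 + 1 / η ^ 2))) := by
  have hlog : 0 < Real.log (1 + 1 / η ^ 2) :=
    Real.log_pos (lt_add_of_pos_right 1 (by positivity))
  have hsq : ∑ j, (s j) ^ 2 ≤ 2 * γ / Real.log (1 + 1 / η ^ 2) := by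
    rw [le_div_iff₀ hlog, Finset.sum_mul]
    calc ∑ j, (s j) ^ 2 * Real.log (1 + 1 / η ^ 2)
        ≤ ∑ j, Real.log (1 + (s j) ^ 2 / η ^ 2) := by
          refine Finset.sum_le_sum fun j _ => ?_
          rw [div_eq_mul_one_div (s j ^ 2)]
          exact mul_log_one_add_le_log_one_add_mul (by positivity) (sq_nonneg _)
            (pow_le_one₀ (hs0 j) (hs1 j))
      _ ≤ 2 * γ := by linarith
  refine ⟨hsq, Real.le_sqrt_of_sq_le ?_⟩
  calc (∑ j, s j) ^ 2 ≤ n * ∑ j, (s j) ^ 2 := by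
        simpa using sq_sum_le_card_mul_sum_sq (s := Finset.univ) (f := s)
    _ ≤ n * (2 * γ / Real.log (1 + 1 / η ^ 2)) := by gcongr
    _ = 2 * n * γ / Real.log (1 + 1 / η ^ 2) := by ring
end
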